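/- arXiv:2406.10570 — 8 statements merged into one kernel-verified Lean document; each statement's English description precedes it below -/
import Mathlib

section
/- Let A, B, X, Y, D, W be finite nonempty sets and m, n ≥ 1. Let (σ_{abd|xyw}) be a family of positive semidefinite matrices on ℂ^m ⊗ ℂ^n (i.e. mn×mn complex matrices indexed by Fin m × Fin n), for a∈A, b∈B, d∈D, x∈X, y∈Y, w∈W. Assume: (o) no-signalling from Dani: ∑_{d∈D} σ_{abd|xyw} is independent of w, and the trace Tr(∑_{d∈D} σ_{abd|xyw}) is independent of w (and of the common w by the previous condition); (i) the partial trace over the first factor σ_{d|w} := Tr₁[∑_{a∈A,b∈B} σ_{abd|xyw}] is independent of x and y; (ii) there exists a rank-one projection ψ on ℂ^m (i.e. ψ = v v* for a unit vector v ∈ ℂ^m) such that ∑_{a∈A,b∈B} σ_{abd|xyw} = ψ ⊗ σ_{d|w} for all d, w, x, y; (iii) the family (σ_{d|w}) is an extremal non-signalling assemblage (with outcome set D, input set W, in dimension n). Then there exists a family (σ_{ab|xy}) of positive semidefinite m×m matrices such that σ_{abd|xyw} = σ_{ab|xy} ⊗ σ_{d|w} for all a, b, d, x, y, w. -/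
open Matrix Kronecker Complex
open scoped BigOperators ComplexOrder

noncomputable def Pauli : Fin 3 → Matrix (Fin 2) (Fin 2) ℂ :=
  ![!![0, 1; 1, 0], !![0, -Complex.I; Complex.I, 0], !![1, 0; 0, -1]]

noncomputable def PProj (d : Fin 2) (w : Fin 3) : Matrix (Fin 2) (Fin 2) ℂ :=
  ((1 : ℂ) / 2) • ((1 : Matrix (Fin 2) (Fin 2) ℂ) + ((-1 : ℂ) ^ (d : ℕ)) • Pauli w)

noncomputable def E00 : Matrix (Fin 2) (Fin 2) ℂ := !![1, 0; 0, 0]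
noncomputable def E11 : Matrix (Fin 2) (Fin 2) ℂ := !![0, 0; 0, 1]

def IsNSAssemblage {D W ι : Type*} [Fintype D] [Fintype ι]
    (σ : D → W → Matrix ι ι ℂ) : Prop :=
  (∀ d w, (σ d w).PosSemidef) ∧
  (∀ w w', ∑ d, σ d w = ∑ d, σ d w') ∧
  (∀ w, (∑ d, σ d w).trace = 1)

def IsExtremalNSAssemblage {D W ι : Type*} [Fintype D] [Fintype ι]
    (σ : D → W → Matrix ι ι ℂ) : Prop :=
  IsNSAssemblage σ ∧
  ∀ (t : ℝ) (τ τ' : D → W → Matrix ι ι ℂ), 0 < t → t < 1 →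
    IsNSAssemblage τ → IsNSAssemblage τ' →
    (∀ d w, σ d w = (t : ℂ) • τ d w + ((1 - t : ℝ) : ℂ) • τ' d w) →
    ∀ d w, τ d w = σ d w ∧ τ' d w = σ d w

noncomputable def ptrace1 {α β : Type*} [Fintype α] (X : Matrix (α × β) (α × β) ℂ) :
    Matrix β β ℂ :=
  Matrix.of fun i j => ∑ p : α, X (p, i) (p, j)

noncomputable def ptrace2 {α β : Type*} [Fintype β] (X : Matrix (α × β) (α × β) ℂ) :
    Matrix α α ℂ :=
  Matrix.of fun i j => ∑ p : β, X (i, p) (j, p)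

noncomputable def ptrace12 {α β γ : Type*} [Fintype α] [Fintype β]
    (X : Matrix (α × β × γ) (α × β × γ) ℂ) : Matrix γ γ ℂ :=
  Matrix.of fun i j => ∑ p : α, ∑ q : β, X (p, q, i) (p, q, j)

def IsQuantumAssemblage {A B X Y ι : Type*} [Fintype A] [Fintype B]
    [Fintype ι] [DecidableEq ι]
    (σ : A → B → X → Y → Matrix ι ι ℂ) : Prop :=
  ∃ (nA nB : ℕ)
    (ρ : Matrix (Fin nA × Fin nB × ι) (Fin nA × Fin nB × ι) ℂ)
    (M : A → X → Matrix (Fin nA) (Fin nA) ℂ)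
    (N : B → Y → Matrix (Fin nB) (Fin nB) ℂ),
    ρ.PosSemidef ∧ ρ.trace = 1 ∧
    (∀ a x, (M a x).PosSemidef) ∧ (∀ x, ∑ a, M a x = 1) ∧
    (∀ b y, (N b y).PosSemidef) ∧ (∀ y, ∑ b, N b y = 1) ∧
    (∀ a b x y, σ a b x y =
      ptrace12 ((M a x ⊗ₖ (N b y ⊗ₖ (1 : Matrix ι ι ℂ))) * ρ))

theorem ptrace1_sum {α β κ : Type*} [Fintype α] (s : Finset κ)
    (X : κ → Matrix (α × β) (α × β) ℂ) :
    ptrace1 (∑ k ∈ s, X k) = ∑ k ∈ s, ptrace1 (X k) := by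
  ext i j
  simp only [ptrace1, Matrix.of_apply, Matrix.sum_apply]
  exact Finset.sum_comm

theorem ptrace1_sub {α β : Type*} [Fintype α] (X Y : Matrix (α × β) (α × β) ℂ) :
    ptrace1 (X - Y) = ptrace1 X - ptrace1 Y := by
  ext i j
  simp [ptrace1]

theorem Matrix.PosSemidef.ptrace1 {α β : Type*} [Fintype α] [Fintype β]
    {X : Matrix (α × β) (α × β) ℂ} (hX : X.PosSemidef) : (ptrace1 X).PosSemidef := by
  have h : _root_.ptrace1 X = ∑ p : α, X.submatrix (fun i => (p, i)) (fun i => (p, i)) := by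
    ext i j
    simp [_root_.ptrace1, Matrix.sum_apply]
  rw [h]
  exact Matrix.posSemidef_sum _ fun p _ => hX.submatrix _

theorem Matrix.PosSemidef.eq_zero_of_neg {ι : Type*} [Fintype ι] {M : Matrix ι ι ℂ}
    (h : M.PosSemidef) (h' : (-M).PosSemidef) : M = 0 := by
  rw [← h.trace_eq_zero_iff]
  have h1 := h.trace_nonneg
  have h2 := h'.trace_nonneg
  rw [Matrix.trace_neg, neg_nonneg] at h2
  exact le_antisymm h2 h1

theorem Matrix.PosSemidef.mul_eq_zero_of_conj_eq_zero {ι κ : Type*} [Fintype ι] [Fintype κ]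
    [DecidableEq κ] {S : Matrix ι ι ℂ} {Q : Matrix ι κ ℂ} (hS : S.PosSemidef)
    (h : Qᴴ * S * Q = 0) : S * Q = 0 := by
  refine Matrix.toLin'.injective (LinearMap.ext fun x => ?_)
  rw [Matrix.toLin'_apply, ← Matrix.mulVec_mulVec, map_zero, LinearMap.zero_apply,
    ← hS.dotProduct_mulVec_zero_iff, Matrix.star_mulVec, ← Matrix.dotProduct_mulVec,
    Matrix.mulVec_mulVec, Matrix.mulVec_mulVec, h, Matrix.zero_mulVec,
    dotProduct_zero]

/-- A positive semidefinite matrix dominated by `v v* ⊗ R` with `v` a unit vector is itself of the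
form `v v* ⊗ T`. -/
theorem eq_vecMulVec_kronecker_ptrace1 {α β : Type*} [Fintype α] [Fintype β] [DecidableEq α]
    [DecidableEq β] {v : α → ℂ} (hv : star v ⬝ᵥ v = 1) {R : Matrix β β ℂ}
    {S : Matrix (α × β) (α × β) ℂ} (hS : S.PosSemidef)
    (hle : (vecMulVec v (star v) ⊗ₖ R - S).PosSemidef) :
    S = vecMulVec v (star v) ⊗ₖ ptrace1 S := by
  set P : Matrix α α ℂ := vecMulVec v (star v) with hP
  have hPP : P * P = P := by
    rw [hP, Matrix.vecMulVec_mul_vecMulVec, hv, one_smul]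
  have hPh : Pᴴ = P := by
    rw [hP, Matrix.conjTranspose_vecMulVec, star_star]
  set E : Matrix (α × β) (α × β) ℂ := P ⊗ₖ (1 : Matrix β β ℂ) with hE
  have hEh : Eᴴ = E := by
    rw [hE, Matrix.conjTranspose_kronecker, hPh, Matrix.conjTranspose_one]
  have hRE : (P ⊗ₖ R) * (1 - E) = 0 := by
    rw [mul_sub, mul_one, hE, ← Matrix.mul_kronecker_mul, hPP, mul_one, sub_self]
  have hzero : (1 - E)ᴴ * S * (1 - E) = 0 := by
    refine (hS.conjTranspose_mul_mul_same _).eq_zero_of_neg ?_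
    have h := hle.conjTranspose_mul_mul_same (1 - E)
    rwa [mul_assoc, sub_mul, hRE, zero_sub, mul_neg, ← mul_assoc] at h
  have hSE : S = S * E := by
    have h := hS.mul_eq_zero_of_conj_eq_zero hzero
    rw [mul_sub, mul_one] at h
    exact sub_eq_zero.mp h
  have hES : S = E * S * E := by
    have h := congrArg Matrix.conjTranspose hSE
    rw [Matrix.conjTranspose_mul, hS.1.eq, hEh] at h
    rw [← h, ← hSE]
  obtain ⟨T, hT⟩ : ∃ T : Matrix β β ℂ, S = P ⊗ₖ T := by
    refine ⟨Matrix.of fun i j => ∑ q, ∑ p, star (v p) * S (p, i) (q, j) * v q, ?_⟩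
    ext ⟨p, i⟩ ⟨q, j⟩
    conv_lhs => rw [hES]
    simp only [Matrix.mul_apply, hE, Matrix.kroneckerMap_apply, Fintype.sum_prod_type,
      Matrix.one_apply, mul_ite, ite_mul, mul_one, mul_zero, zero_mul, Finset.sum_ite_eq,
      Finset.sum_ite_eq', Finset.mem_univ, if_true, Matrix.of_apply, hP,
      Matrix.vecMulVec_apply, Pi.star_apply, Finset.sum_mul, Finset.mul_sum]
    refine Finset.sum_congr rfl fun _ _ => Finset.sum_congr rfl fun _ _ => ?_
    ring
  have hTr : ptrace1 S = T := by
    ext i j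
    rw [hT]
    simp only [ptrace1, Matrix.of_apply, Matrix.kroneckerMap_apply, hP, Matrix.vecMulVec_apply,
      Pi.star_apply, ← Finset.sum_mul]
    have : ∑ p, v p * star (v p) = 1 := by
      rw [← hv, dotProduct]
      exact Finset.sum_congr rfl fun _ _ => mul_comm _ _
    rw [this, one_mul]
  rw [hTr]
  exact hT

theorem eq_zero_of_trace_sum_eq_zero {D ι : Type*} [Fintype D] [Fintype ι]
    {τ : D → Matrix ι ι ℂ} (hτ : ∀ d, (τ d).PosSemidef) (h : (∑ d, τ d).trace = 0) (d : D) :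
    τ d = 0 := by
  rw [Matrix.trace_sum] at h
  rw [← (hτ d).trace_eq_zero_iff]
  exact (Finset.sum_eq_zero_iff_of_nonneg fun d _ => (hτ d).trace_nonneg).mp h d
    (Finset.mem_univ d)

/-- A non-signalling family of constant trace `t`, rescaled to a non-signalling assemblage. -/
theorem isNSAssemblage_inv_smul {D W ι : Type*} [Fintype D] [Fintype ι]
    {τ : D → W → Matrix ι ι ℂ} {t : ℝ} (ht : 0 < t) (hτ : ∀ d w, (τ d w).PosSemidef)
    (hns : ∀ w w', ∑ d, τ d w = ∑ d, τ d w') (htr : ∀ w, (∑ d, τ d w).trace = (t : ℂ)) :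
    IsNSAssemblage fun d w => ((t⁻¹ : ℝ) : ℂ) • τ d w := by
  refine ⟨fun d w => (hτ d w).smul ?_, fun w w' => ?_, fun w => ?_⟩
  · exact_mod_cast (inv_pos.mpr ht).le
  · rw [← Finset.smul_sum, ← Finset.smul_sum, hns w w']
  · rw [← Finset.smul_sum, Matrix.trace_smul, htr w, smul_eq_mul]
    exact_mod_cast inv_mul_cancel₀ ht.ne'

/-- A non-signalling family dominated by an extremal assemblage is proportional to it. -/
theorem IsExtremalNSAssemblage.exists_eq_smul {D W ι : Type*} [Fintype D] [Nonempty W]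
    [Fintype ι] {σ τ : D → W → Matrix ι ι ℂ} (hσ : IsExtremalNSAssemblage σ)
    (hτ : ∀ d w, (τ d w).PosSemidef) (hle : ∀ d w, (σ d w - τ d w).PosSemidef)
    (hns : ∀ w w', ∑ d, τ d w = ∑ d, τ d w') :
    ∃ t : ℂ, 0 ≤ t ∧ ∀ d w, τ d w = t • σ d w := by
  obtain ⟨⟨-, hσns, hσtr⟩, hext⟩ := hσ
  obtain ⟨w₀⟩ := ‹Nonempty W›
  have hnonneg : 0 ≤ (∑ d, τ d w₀).trace :=
    (Matrix.posSemidef_sum _ fun d _ => hτ d w₀).trace_nonneg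
  obtain ⟨t, ht0, ht⟩ : ∃ t : ℝ, 0 ≤ t ∧ (∑ d, τ d w₀).trace = (t : ℂ) := by
    obtain ⟨h1, h2⟩ := Complex.nonneg_iff.mp hnonneg
    exact ⟨_, h1, Complex.ext rfl h2.symm⟩
  have htr : ∀ w, (∑ d, τ d w).trace = (t : ℂ) := fun w => by rw [hns w w₀, ht]
  have htr' : ∀ w, (∑ d, (σ d w - τ d w)).trace = ((1 - t : ℝ) : ℂ) := fun w => by
    rw [Finset.sum_sub_distrib, Matrix.trace_sub, hσtr, htr]
    push_cast
    rfl
  have ht1 : t ≤ 1 := by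
    have h := (Matrix.posSemidef_sum Finset.univ fun d _ => hle d w₀).trace_nonneg
    rw [htr' w₀] at h
    have h' : (0 : ℝ) ≤ 1 - t := by exact_mod_cast h
    linarith
  refine ⟨(t : ℂ), by exact_mod_cast ht0, fun d w => ?_⟩
  rcases ht0.eq_or_lt with rfl | hpos
  · rw [Complex.ofReal_zero, zero_smul]
    exact eq_zero_of_trace_sum_eq_zero (τ := fun d => τ d w) (fun d => hτ d w)
      (by simpa using htr w) d
  rcases ht1.eq_or_lt with rfl | hlt
  · rw [Complex.ofReal_one, one_smul]
    exact (sub_eq_zero.mp (eq_zero_of_trace_sum_eq_zero (τ := fun d => σ d w - τ d w)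
      (fun d => hle d w) (by simpa using htr' w) d)).symm
  · have hpos' : 0 < 1 - t := sub_pos.mpr hlt
    have hne : (t : ℂ) ≠ 0 := by exact_mod_cast hpos.ne'
    have hne' : ((1 - t : ℝ) : ℂ) ≠ 0 := by exact_mod_cast hpos'.ne'
    have h := (hext t _ _ hpos hlt (isNSAssemblage_inv_smul hpos hτ hns htr)
      (isNSAssemblage_inv_smul hpos' hle
        (fun w w' => by
          rw [Finset.sum_sub_distrib, Finset.sum_sub_distrib, hσns w w', hns w w']) htr')
      (fun d w => by
        rw [smul_smul, smul_smul, Complex.ofReal_inv, Complex.ofReal_inv, mul_inv_cancel₀ hne,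
          mul_inv_cancel₀ hne', one_smul, one_smul, add_sub_cancel]) d w).1
    rw [← h, smul_smul, Complex.ofReal_inv, mul_inv_cancel₀ hne, one_smul]

theorem stmt0 {A B X Y D W : Type*}
    [Fintype A] [Fintype B] [Fintype X] [Fintype Y] [Fintype D] [Fintype W]
    [Nonempty A] [Nonempty B] [Nonempty X] [Nonempty Y] [Nonempty D] [Nonempty W]
    {m n : ℕ} (hm : 1 ≤ m) (hn : 1 ≤ n)
    (σ : A → B → D → X → Y → W → Matrix (Fin m × Fin n) (Fin m × Fin n) ℂ)
    (hpsd : ∀ a b d x y w, (σ a b d x y w).PosSemidef)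
    -- (o) no-signalling from Dani
    (hns : ∀ a b x y w w', ∑ d, σ a b d x y w = ∑ d, σ a b d x y w')
    (hnstr : ∀ a b x y w w', (∑ d, σ a b d x y w).trace = (∑ d, σ a b d x y w').trace)
    -- (i) the reduced assemblage for Dani is independent of x and y
    (σD : D → W → Matrix (Fin n) (Fin n) ℂ)
    (hi : ∀ d w x y, ptrace1 (∑ a, ∑ b, σ a b d x y w) = σD d w)
    -- (ii) product form with a rank-one projection ψ = v v*
    (v : Fin m → ℂ) (hv : star v ⬝ᵥ v = 1)
    (hii : ∀ d w x y, (∑ a, ∑ b, σ a b d x y w) = vecMulVec v (star v) ⊗ₖ σD d w)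
    -- (iii) extremality
    (hiii : IsExtremalNSAssemblage σD) :
    ∃ σAB : A → B → X → Y → Matrix (Fin m) (Fin m) ℂ,
      (∀ a b x y, (σAB a b x y).PosSemidef) ∧
      ∀ a b d x y w, σ a b d x y w = σAB a b x y ⊗ₖ σD d w := by
  have hsub : ∀ a b d x y w,
      ((∑ a, ∑ b, σ a b d x y w) - σ a b d x y w).PosSemidef := by
    classical
    intro a b d x y w
    rw [← Fintype.sum_prod_type' (f := fun a b => σ a b d x y w),
      ← Finset.sum_erase_add _ _ (Finset.mem_univ (a, b)), add_sub_cancel_right]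
    exact Matrix.posSemidef_sum _ fun p _ => hpsd _ _ _ _ _ _
  have hfactor : ∀ a b d x y w,
      σ a b d x y w = vecMulVec v (star v) ⊗ₖ ptrace1 (σ a b d x y w) := fun a b d x y w =>
    eq_vecMulVec_kronecker_ptrace1 hv (hpsd a b d x y w) (hii d w x y ▸ hsub a b d x y w)
  have hprop : ∀ a b x y, ∃ t : ℂ, 0 ≤ t ∧ ∀ d w, ptrace1 (σ a b d x y w) = t • σD d w := by
    intro a b x y
    refine hiii.exists_eq_smul (τ := fun d w => ptrace1 (σ a b d x y w))
      (fun d w => (hpsd a b d x y w).ptrace1) (fun d w => ?_) (fun w w' => ?_)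
    · rw [← hi d w x y, ← ptrace1_sub]
      exact (hsub a b d x y w).ptrace1
    · rw [← ptrace1_sum, ← ptrace1_sum, hns a b x y w w']
  choose t ht0 ht using hprop
  refine ⟨fun a b x y => t a b x y • vecMulVec v (star v),
    fun a b x y => (Matrix.posSemidef_vecMulVec_self_star v).smul (ht0 a b x y),
    fun a b d x y w => ?_⟩
  rw [hfactor, ht, Matrix.kronecker_smul, Matrix.smul_kronecker]
end

section
/- The family σ*_{d|w} := (1/2)·Π_{d,w} ⊗ E₀₀, for d ∈ {0,1} and w ∈ {1,2,3}, is an extremal non-signalling assemblage of 4×4 matrices (matrices on ℂ² ⊗ ℂ², indexed by Fin 2 × Fin 2). -/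
open Matrix Kronecker Complex
open scoped BigOperators ComplexOrder

theorem mulVec_eq_zero_of_smul_add_smul {ι : Type*} [Fintype ι] {A B : Matrix ι ι ℂ}
    (hA : A.PosSemidef) (hB : B.PosSemidef) {a b : ℝ} (ha : 0 < a) (hb : 0 ≤ b) {v : ι → ℂ}
    (h : ((a : ℂ) • A + (b : ℂ) • B) *ᵥ v = 0) : A *ᵥ v = 0 := by
  rw [← hA.dotProduct_mulVec_zero_iff]
  have h₁ := congrArg (fun x => star v ⬝ᵥ x) h
  simp only [add_mulVec, smul_mulVec, dotProduct_add, dotProduct_smul, dotProduct_zero,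
    smul_eq_mul] at h₁
  have hA' : 0 ≤ (a : ℂ) * (star v ⬝ᵥ A *ᵥ v) :=
    mul_nonneg (by exact_mod_cast ha.le) (hA.dotProduct_mulVec_nonneg v)
  have hB' : 0 ≤ (b : ℂ) * (star v ⬝ᵥ B *ᵥ v) :=
    mul_nonneg (by exact_mod_cast hb) (hB.dotProduct_mulVec_nonneg v)
  have h₂ := ((add_eq_zero_iff_of_nonneg hA' hB').1 h₁).1
  exact (mul_eq_zero.1 h₂).resolve_left (by exact_mod_cast ha.ne')

theorem exists_eq_smul_of_rankOne {ι : Type*} [Fintype ι] [DecidableEq ι]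
    {A B Q : Matrix ι ι ℂ} (hA : A.PosSemidef) (hB : B.PosSemidef) {a b : ℝ} (ha : 0 < a)
    (hb : 0 ≤ b) (hQ : Q.IsHermitian) (hQQ : Q * Q = Q) {x y : ι → ℂ}
    (hxy : Q = vecMulVec x y) {s : ℂ} (h : s • Q = (a : ℂ) • A + (b : ℂ) • B) :
    ∃ c : ℂ, A = c • Q := by
  have h₁ : A * (1 - Q) = 0 := by
    refine Matrix.ext_of_mulVec_single fun i => ?_
    rw [← mulVec_mulVec, zero_mulVec]
    refine mulVec_eq_zero_of_smul_add_smul hA hB ha hb ?_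
    rw [← h, mulVec_mulVec, smul_mul_assoc, mul_sub, hQQ, mul_one, sub_self, smul_zero,
      zero_mulVec]
  have h₂ : A = A * Q := by rwa [mul_sub, mul_one, sub_eq_zero] at h₁
  have h₃ : A = Q * A := by
    have := congrArg conjTranspose h₂
    rwa [conjTranspose_mul, hA.isHermitian.eq, hQ.eq] at this
  have h₄ : A = Q * A * Q := by rw [← h₃]; exact h₂
  refine ⟨(y ᵥ* A) ⬝ᵥ x, ?_⟩
  rw [hxy, vecMulVec_mul, vecMulVec_mul_vecMulVec] at h₄
  rw [hxy, ← vecMulVec_smul]; exact h₄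

theorem PProj_isHermitian (d : Fin 2) (w : Fin 3) : (PProj d w).IsHermitian := by
  ext i j
  fin_cases d <;> fin_cases w <;> fin_cases i <;> fin_cases j <;>
    simp [PProj, Pauli] <;> norm_num

theorem PProj_mul_self (d : Fin 2) (w : Fin 3) : PProj d w * PProj d w = PProj d w := by
  ext i j
  fin_cases d <;> fin_cases w <;> fin_cases i <;> fin_cases j <;>
    simp [PProj, Pauli, Matrix.mul_apply, Fin.sum_univ_two] <;> ring_nf <;> simp <;> norm_num

theorem PProj_eq_vecMulVec (d : Fin 2) (w : Fin 3) :
    ∃ x y : Fin 2 → ℂ, PProj d w = vecMulVec x y := by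
  refine ⟨![![1, (-1) ^ (d : ℕ)], ![1, (-1) ^ (d : ℕ) * I], ![1 - d, d]] w,
    ![![1 / 2, (-1) ^ (d : ℕ) / 2], ![1 / 2, -(-1) ^ (d : ℕ) * I / 2], ![1 - d, d]] w, ?_⟩
  ext i j
  fin_cases d <;> fin_cases w <;> fin_cases i <;> fin_cases j <;>
    simp [PProj, Pauli, vecMulVec_apply] <;> ring_nf <;> simp <;> norm_num

theorem PProj_sum (w : Fin 3) : ∑ d, PProj d w = 1 := by
  simp only [Fin.sum_univ_two, PProj, ← smul_add]
  ext i j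
  simp
  ring

theorem PProj_trace (d : Fin 2) (w : Fin 3) : (PProj d w).trace = 1 := by
  fin_cases d <;> fin_cases w <;> simp [PProj, Pauli, trace_fin_two]

theorem E00_isHermitian : E00.IsHermitian := by
  ext i j
  fin_cases i <;> fin_cases j <;> simp [E00]

theorem E00_mul_self : E00 * E00 = E00 := by
  ext i j
  fin_cases i <;> fin_cases j <;> simp [E00]

theorem E00_eq_vecMulVec : E00 = vecMulVec ![1, 0] ![1, 0] := by
  ext i j
  fin_cases i <;> fin_cases j <;> simp [E00, vecMulVec_apply]

theorem E00_trace : E00.trace = 1 := by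
  simp [E00, trace_fin_two]

theorem posSemidef_of_isHermitian_of_mul_self {ι : Type*} [Fintype ι] {Q : Matrix ι ι ℂ}
    (hQ : Q.IsHermitian) (hQQ : Q * Q = Q) : Q.PosSemidef := by
  have := posSemidef_conjTranspose_mul_self Q
  rwa [hQ.eq, hQQ] at this

theorem PProj_kronecker_E00_isHermitian (d : Fin 2) (w : Fin 3) :
    (PProj d w ⊗ₖ E00).IsHermitian := by
  rw [IsHermitian, conjTranspose_kronecker, (PProj_isHermitian d w).eq, E00_isHermitian.eq]

theorem PProj_kronecker_E00_mul_self (d : Fin 2) (w : Fin 3) :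
    (PProj d w ⊗ₖ E00) * (PProj d w ⊗ₖ E00) = PProj d w ⊗ₖ E00 := by
  rw [← mul_kronecker_mul, PProj_mul_self, E00_mul_self]

theorem PProj_kronecker_E00_eq_vecMulVec (d : Fin 2) (w : Fin 3) :
    ∃ x y : Fin 2 × Fin 2 → ℂ, PProj d w ⊗ₖ E00 = vecMulVec x y := by
  obtain ⟨x, y, h⟩ := PProj_eq_vecMulVec d w
  refine ⟨fun p => x p.1 * ![1, 0] p.2, fun p => y p.1 * ![1, 0] p.2, ?_⟩
  ext p q
  rw [h, E00_eq_vecMulVec]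
  simp only [kroneckerMap_apply, vecMulVec_apply]
  ring

theorem isNSAssemblage_PProj_kronecker_E00 :
    IsNSAssemblage (fun (d : Fin 2) (w : Fin 3) => ((1 : ℂ) / 2) • (PProj d w ⊗ₖ E00)) := by
  refine ⟨fun d w => ?_, fun w w' => ?_, fun w => ?_⟩
  · refine (posSemidef_of_isHermitian_of_mul_self (PProj_kronecker_E00_isHermitian d w)
      (PProj_kronecker_E00_mul_self d w)).smul ?_
    norm_num [Complex.le_def]
  · have h (w) : ∑ d, PProj d w ⊗ₖ E00 = 1 ⊗ₖ E00 := by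
      rw [Fin.sum_univ_two, ← add_kronecker, ← Fin.sum_univ_two (fun d => PProj d w), PProj_sum]
    simp only [← Finset.smul_sum, h]
  · simp [trace_add, trace_smul, trace_kronecker, PProj_trace, E00_trace]
    norm_num

theorem eq_of_isNSAssemblage_smul_PProj_kronecker_E00
    {τ : Fin 2 → Fin 3 → Matrix (Fin 2 × Fin 2) (Fin 2 × Fin 2) ℂ}
    (hτ : IsNSAssemblage τ) {c : Fin 2 → Fin 3 → ℂ}
    (hc : ∀ d w, τ d w = c d w • (PProj d w ⊗ₖ E00)) (d : Fin 2) (w : Fin 3) :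
    τ d w = ((1 : ℂ) / 2) • (PProj d w ⊗ₖ E00) := by
  obtain ⟨-, hsum, htrace⟩ := hτ
  have htr : c 0 w + c 1 w = 1 := by
    simpa [hc, trace_add, trace_smul, trace_kronecker, PProj_trace, E00_trace] using htrace w
  have entry (i j : Fin 2) (w w' : Fin 3) :
      c 0 w * PProj 0 w i j + c 1 w * PProj 1 w i j =
        c 0 w' * PProj 0 w' i j + c 1 w' * PProj 1 w' i j := by
    simpa [hc, E00] using congrFun₂ (hsum w w') (i, 0) (j, 0)
  have heq : c 0 w = c 1 w := by
    fin_cases w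
    · have := entry 0 1 0 2
      simp [PProj, Pauli] at this ⊢
      linear_combination 2 * this
    · have := entry 0 1 1 2
      simp [PProj, Pauli] at this ⊢
      linear_combination (2 * I) * this + (c 0 1 - c 1 1) * I_sq
    · have h₀ := entry 0 0 2 0
      have h₁ := entry 1 1 2 0
      simp [PProj, Pauli] at h₀ h₁ ⊢
      linear_combination h₀ - h₁
  rw [hc]
  congr 1
  fin_cases d
  · simp only [Fin.zero_eta]
    linear_combination htr / 2 + heq / 2
  · simp only [Fin.mk_one]
    linear_combination htr / 2 - heq / 2

theorem eq_of_smul_PProj_kronecker_E00_eq_smul_add_smul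
    {τ τ' : Fin 2 → Fin 3 → Matrix (Fin 2 × Fin 2) (Fin 2 × Fin 2) ℂ}
    (hτ : IsNSAssemblage τ) (hτ' : IsNSAssemblage τ') {a b : ℝ} (ha : 0 < a) (hb : 0 ≤ b)
    (h : ∀ d w, ((1 : ℂ) / 2) • (PProj d w ⊗ₖ E00) = (a : ℂ) • τ d w + (b : ℂ) • τ' d w)
    (d : Fin 2) (w : Fin 3) : τ d w = ((1 : ℂ) / 2) • (PProj d w ⊗ₖ E00) := by
  have hex (d w) : ∃ c : ℂ, τ d w = c • (PProj d w ⊗ₖ E00) := by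
    obtain ⟨x, y, hxy⟩ := PProj_kronecker_E00_eq_vecMulVec d w
    exact exists_eq_smul_of_rankOne (hτ.1 d w) (hτ'.1 d w) ha hb
      (PProj_kronecker_E00_isHermitian d w) (PProj_kronecker_E00_mul_self d w) hxy (h d w)
  choose c hc using hex
  exact eq_of_isNSAssemblage_smul_PProj_kronecker_E00 hτ hc d w

theorem stmt1 :
    IsExtremalNSAssemblage (fun (d : Fin 2) (w : Fin 3) =>
      ((1 : ℂ) / 2) • (PProj d w ⊗ₖ E00)) := by
  refine ⟨isNSAssemblage_PProj_kronecker_E00, fun t τ τ' ht ht' hτ hτ' h d w => ⟨?_, ?_⟩⟩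
  · exact eq_of_smul_PProj_kronecker_E00_eq_smul_add_smul hτ hτ' ht (sub_pos.2 ht').le h d w
  · exact eq_of_smul_PProj_kronecker_E00_eq_smul_add_smul hτ' hτ (sub_pos.2 ht') ht.le
      (fun d w => (h d w).trans (add_comm _ _)) d w
end

section
/- Define the 4×4 Hermitian matrices F_{d,w} := 2·Π_{1−d,w} ⊗ E₀₀ + 1₂ ⊗ E₁₁ for d ∈ {0,1}, w ∈ {1,2,3}. Then for every non-signalling assemblage (σ_{d|w}) of 4×4 matrices (outcome set {0,1}, input set {1,2,3}): (a) the real part of ∑_{d,w} Tr(F_{d,w} σ_{d|w}) is nonnegative; and (b) this sum equals 0 if and only if σ_{d|w} = (1/2)·Π_{d,w} ⊗ E₀₀ for all d, w. -/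
open Matrix Kronecker Complex
open scoped BigOperators ComplexOrder

noncomputable def Fop (d : Fin 2) (w : Fin 3) : Matrix (Fin 2 × Fin 2) (Fin 2 × Fin 2) ℂ :=
  (2 : ℂ) • (PProj (1 - d) w ⊗ₖ E00) + (1 : Matrix (Fin 2) (Fin 2) ℂ) ⊗ₖ E11

open scoped MatrixOrder in
theorem exists_eq_conjTranspose_mul_self_of_posSemidef {ι : Type*} [Fintype ι] [DecidableEq ι]
    {A : Matrix ι ι ℂ} (hA : A.PosSemidef) : ∃ G : Matrix ι ι ℂ, A = Gᴴ * G :=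
  CStarAlgebra.nonneg_iff_eq_star_mul_self.mp hA.nonneg

/-- The trace of a product of two positive semidefinite matrices is nonnegative. -/
theorem trace_mul_nonneg_of_posSemidef {ι : Type*} [Fintype ι] [DecidableEq ι]
    {A B : Matrix ι ι ℂ} (hA : A.PosSemidef) (hB : B.PosSemidef) : 0 ≤ (A * B).trace := by
  obtain ⟨G, rfl⟩ := exists_eq_conjTranspose_mul_self_of_posSemidef hA
  rw [Matrix.mul_assoc, Matrix.trace_mul_comm]
  exact (hB.mul_mul_conjTranspose_same G).trace_nonneg

/-- Positive semidefinite matrices whose product has trace zero are orthogonal. -/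
theorem mul_eq_zero_of_posSemidef_of_trace_mul_eq_zero {ι : Type*} [Fintype ι] [DecidableEq ι]
    {A B : Matrix ι ι ℂ} (hA : A.PosSemidef) (hB : B.PosSemidef) (h : (A * B).trace = 0) :
    A * B = 0 := by
  obtain ⟨G, rfl⟩ := exists_eq_conjTranspose_mul_self_of_posSemidef hA
  obtain ⟨S, rfl⟩ := exists_eq_conjTranspose_mul_self_of_posSemidef hB
  have h0 : ((S * Gᴴ)ᴴ * (S * Gᴴ)).trace = 0 := by
    rw [← h, Matrix.mul_assoc Gᴴ, Matrix.trace_mul_comm Gᴴ]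
    simp [Matrix.mul_assoc]
  have h1 : S * Gᴴ = 0 := trace_conjTranspose_mul_self_eq_zero_iff.mp h0
  have h2 : G * Sᴴ = 0 := by simpa using congrArg conjTranspose h1
  rw [Matrix.mul_assoc, ← Matrix.mul_assoc G, h2, Matrix.zero_mul, Matrix.mul_zero]

theorem Pauli_mul_self (w : Fin 3) : Pauli w * Pauli w = 1 := by
  ext i j
  fin_cases w <;> fin_cases i <;> fin_cases j <;> simp [Pauli, Matrix.mul_apply]

theorem PProj_one_sub (d : Fin 2) (w : Fin 3) : PProj (1 - d) w = 1 - PProj d w := by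
  ext i j
  fin_cases d <;> fin_cases w <;> fin_cases i <;> fin_cases j <;>
    simp [PProj, Pauli] <;> ring

theorem E11_mul_self : E11 * E11 = E11 := by
  ext i j; fin_cases i <;> fin_cases j <;> simp [E11]
theorem E00_mul_E11 : E00 * E11 = 0 := by
  ext i j; fin_cases i <;> fin_cases j <;> simp [E00, E11]
theorem E11_mul_E00 : E11 * E00 = 0 := by
  ext i j; fin_cases i <;> fin_cases j <;> simp [E00, E11]
theorem E00_add_E11 : E00 + E11 = 1 := by
  ext i j; fin_cases i <;> fin_cases j <;> simp [E00, E11]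
theorem E11_isHermitian : E11.IsHermitian := by
  ext i j; fin_cases i <;> fin_cases j <;> simp [E11]

theorem posSemidef_of_isHermitian_of_mul_self_s2 {ι : Type*} [Fintype ι]
    {A : Matrix ι ι ℂ} (hA : A.IsHermitian) (h : A * A = A) : A.PosSemidef := by
  have := posSemidef_conjTranspose_mul_self A
  rwa [hA.eq, h] at this

theorem Fop_posSemidef (d : Fin 2) (w : Fin 3) : (Fop d w).PosSemidef := by
  have hP := posSemidef_of_isHermitian_of_mul_self_s2 (PProj_isHermitian (1 - d) w)
    (PProj_mul_self (1 - d) w)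
  have h0 := posSemidef_of_isHermitian_of_mul_self_s2 E00_isHermitian E00_mul_self
  have h1 := posSemidef_of_isHermitian_of_mul_self_s2 E11_isHermitian E11_mul_self
  exact ((hP.kronecker h0).smul (by norm_num)).add (PosSemidef.one.kronecker h1)

theorem PProj_mul_PProj_one_sub (d : Fin 2) (w : Fin 3) : PProj d w * PProj (1 - d) w = 0 := by
  rw [PProj_one_sub, Matrix.mul_sub, Matrix.mul_one, PProj_mul_self, sub_self]

theorem Fop_mul_PProj_kronecker_E00 (d : Fin 2) (w : Fin 3) :
    Fop d w * (PProj d w ⊗ₖ E00) = 0 := by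
  have h : PProj (1 - d) w * PProj d w = 0 := by
    simpa using PProj_mul_PProj_one_sub (1 - d) w
  simp [Fop, Matrix.add_mul, ← Matrix.mul_kronecker_mul, h, E11_mul_E00]

/-- `Fop d w` is invertible on the orthogonal complement of `PProj d w ⊗ₖ E00`. -/
theorem leftInverse_mul_Fop (d : Fin 2) (w : Fin 3) :
    (((1 : ℂ) / 2) • (PProj (1 - d) w ⊗ₖ E00) + (1 : Matrix (Fin 2) (Fin 2) ℂ) ⊗ₖ E11) * Fop d w
      = 1 - PProj d w ⊗ₖ E00 := by
  have h : (1 : Matrix (Fin 2 × Fin 2) (Fin 2 × Fin 2) ℂ) = 1 ⊗ₖ E00 + 1 ⊗ₖ E11 := by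
    rw [← kronecker_add, E00_add_E11, one_kronecker_one]
  simp only [Fop, Matrix.add_mul, Matrix.mul_add, Matrix.smul_mul, Matrix.mul_smul,
    ← Matrix.mul_kronecker_mul, PProj_mul_self, E00_mul_self, E00_mul_E11, E11_mul_E00,
    E11_mul_self, kronecker_zero, Matrix.mul_one, smul_zero, add_zero, zero_add, h]
  have hadd : (1 - PProj d w) ⊗ₖ E00 + PProj d w ⊗ₖ E00 = 1 ⊗ₖ E00 := by
    rw [← add_kronecker, sub_add_cancel]
  rw [PProj_one_sub, ← hadd]
  module

theorem PProj_apply_mul_apply (d : Fin 2) (w : Fin 3) (i j k l : Fin 2) :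
    PProj d w i j * PProj d w k l = PProj d w k j * PProj d w i l := by
  fin_cases d <;> fin_cases w <;> fin_cases i <;> fin_cases j <;> fin_cases k <;> fin_cases l <;>
    simp [PProj, Pauli] <;> ring_nf <;> simp
  all_goals norm_num

theorem E00_apply_mul_apply (i j k l : Fin 2) : E00 i j * E00 k l = E00 k j * E00 i l := by
  fin_cases i <;> fin_cases j <;> fin_cases k <;> fin_cases l <;> simp [E00]

/-- Compression by a matrix whose `2 × 2` minors vanish. -/
theorem mul_mul_eq_trace_smul_of_apply_mul_apply {ι : Type*} [Fintype ι] {R : Matrix ι ι ℂ}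
    (hR : ∀ i j k l, R i j * R k l = R k j * R i l) (X : Matrix ι ι ℂ) :
    R * X * R = (R * X).trace • R := by
  ext i l
  simp only [Matrix.mul_apply, Matrix.smul_apply, Matrix.trace, Matrix.diag_apply, smul_eq_mul,
    Finset.sum_mul]
  refine Finset.sum_congr rfl fun k _ => Finset.sum_congr rfl fun j _ => ?_
  linear_combination X j k * hR i j k l

/-- Compression by the rank-one projector `PProj d w ⊗ₖ E00`. -/
theorem PProj_kronecker_E00_mul_mul (d : Fin 2) (w : Fin 3)
    (X : Matrix (Fin 2 × Fin 2) (Fin 2 × Fin 2) ℂ) :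
    (PProj d w ⊗ₖ E00) * X * (PProj d w ⊗ₖ E00)
      = ((PProj d w ⊗ₖ E00) * X).trace • (PProj d w ⊗ₖ E00) := by
  refine mul_mul_eq_trace_smul_of_apply_mul_apply (fun i j k l => ?_) X
  change PProj d w i.1 j.1 * E00 i.2 j.2 * (PProj d w k.1 l.1 * E00 k.2 l.2)
    = PProj d w k.1 j.1 * E00 k.2 j.2 * (PProj d w i.1 l.1 * E00 i.2 l.2)
  rw [mul_mul_mul_comm, PProj_apply_mul_apply, E00_apply_mul_apply, mul_mul_mul_comm]

theorem exists_eq_smul_of_Fop_mul_eq_zero {d : Fin 2} {w : Fin 3}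
    {X : Matrix (Fin 2 × Fin 2) (Fin 2 × Fin 2) ℂ} (hX : X.IsHermitian) (h : Fop d w * X = 0) :
    ∃ p : ℂ, X = p • (PProj d w ⊗ₖ E00) := by
  have h1 : (PProj d w ⊗ₖ E00) * X = X := by
    have h2 := congrArg (fun M => M * X) (leftInverse_mul_Fop d w)
    simp only [Matrix.mul_assoc, h, Matrix.mul_zero, Matrix.sub_mul, Matrix.one_mul] at h2
    exact (sub_eq_zero.mp h2.symm).symm
  have h2 : X * (PProj d w ⊗ₖ E00) = X := by
    have h3 := congrArg conjTranspose h1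
    rwa [conjTranspose_mul, conjTranspose_kronecker, hX.eq, (PProj_isHermitian d w).eq,
      E00_isHermitian.eq] at h3
  refine ⟨((PProj d w ⊗ₖ E00) * X).trace, ?_⟩
  rw [← PProj_kronecker_E00_mul_mul, h1, h2]

/-- No-signalling forces the weights on the Pauli eigenprojectors to be uniform. -/
theorem weights_eq_half {p : Fin 2 → Fin 3 → ℂ}
    (hσ : IsNSAssemblage fun d w => p d w • (PProj d w ⊗ₖ E00)) (d : Fin 2) (w : Fin 3) :
    p d w = 1 / 2 := by
  obtain ⟨-, hns, htr⟩ := hσ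
  have hsum (w : Fin 3) : p 0 w + p 1 w = 1 := by
    have hE : E00.trace = 1 := by simp [E00, Matrix.trace]
    simpa [Fin.sum_univ_two, trace_kronecker, PProj_trace, hE] using htr w
  have hX := congrFun (congrFun (hns 0 2) (0, 0)) (1, 0)
  have hY := congrFun (congrFun (hns 1 2) (0, 0)) (1, 0)
  have hZ := congrFun (congrFun (hns 2 0) (0, 0)) (0, 0)
  simp [Fin.sum_univ_two, PProj, Pauli, E00] at hX hY hZ
  have h0 := hsum 0
  have h1 := hsum 1
  have h2 := hsum 2
  have hY' : p 0 1 = p 1 1 := by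
    have := congrArg (fun z => z * (2 * I)) hY
    ring_nf at this
    simp at this
    linear_combination this
  fin_cases d <;> fin_cases w <;> simp <;> grind

theorem stmt2 (σ : Fin 2 → Fin 3 → Matrix (Fin 2 × Fin 2) (Fin 2 × Fin 2) ℂ)
    (hσ : IsNSAssemblage σ) :
    0 ≤ (∑ d, ∑ w, (Fop d w * σ d w).trace).re ∧
    ((∑ d, ∑ w, (Fop d w * σ d w).trace) = 0 ↔
      ∀ d w, σ d w = ((1 : ℂ) / 2) • (PProj d w ⊗ₖ E00)) := by
  have hpos := hσ.1
  have hterm (d : Fin 2) (w : Fin 3) : 0 ≤ (Fop d w * σ d w).trace :=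
    trace_mul_nonneg_of_posSemidef (Fop_posSemidef d w) (hpos d w)
  have hrow (d : Fin 2) : 0 ≤ ∑ w, (Fop d w * σ d w).trace :=
    Finset.sum_nonneg fun w _ => hterm d w
  refine ⟨(Complex.le_def.mp (Finset.sum_nonneg fun d _ => hrow d)).1, fun h => ?_, fun h => ?_⟩
  · have hzero (d : Fin 2) (w : Fin 3) : (Fop d w * σ d w).trace = 0 :=
      (Finset.sum_eq_zero_iff_of_nonneg fun w _ => hterm d w).mp
        ((Finset.sum_eq_zero_iff_of_nonneg fun d _ => hrow d).mp h d (Finset.mem_univ d))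
        w (Finset.mem_univ w)
    have hex (d : Fin 2) (w : Fin 3) : ∃ p : ℂ, σ d w = p • (PProj d w ⊗ₖ E00) :=
      exists_eq_smul_of_Fop_mul_eq_zero (hpos d w).isHermitian
        (mul_eq_zero_of_posSemidef_of_trace_mul_eq_zero (Fop_posSemidef d w) (hpos d w)
          (hzero d w))
    choose p hp using hex
    obtain rfl : σ = fun d w => p d w • (PProj d w ⊗ₖ E00) := by
      funext d w
      exact hp d w
    intro d w
    simp only [weights_eq_half hσ d w]
  · simp [h, Fop_mul_PProj_kronecker_E00]
end

section
/- Let A, B, X, Y be finite sets and let f : A × B × Fin 2 × X × Y × Fin 3 → ℝ. Suppose that for every quantum assemblage (σ_{ab|xy}) of 2×2 matrices, the real part of ∑_{a,b,d,x,y,w} f(a,b,d,x,y,w)·Tr(Π_{d,w}·σ_{ab|xy}) is nonnegative. Then for every quantum assemblage (σ_{ab|xy}) of 2×2 matrices and every positive semidefinite matrix M₀ on ℂ² ⊗ ℂ² with M₀ ≤ 1, the real part of ∑_{a,b,d,x,y,w} f(a,b,d,x,y,w)·Tr(M₀·(Π_{d,w} ⊗ σ_{ab|xy})) is nonnegative.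 -/
open Matrix Kronecker Complex
open scoped BigOperators ComplexOrder

/-- Contraction of the second tensor factor of `M` against `S`, i.e. `Tr₂ (M (1 ⊗ S))`. -/
def contractSnd {α β : Type*} [Fintype β] (M : Matrix (α × β) (α × β) ℂ)
    (S : Matrix β β ℂ) : Matrix α α ℂ :=
  Matrix.of fun i j => ∑ k, ∑ m, M (i, k) (j, m) * S m k

theorem trace_mul_kronecker_eq_trace_mul_contractSnd {α β : Type*} [Fintype α] [Fintype β]
    (M : Matrix (α × β) (α × β) ℂ) (P : Matrix α α ℂ) (S : Matrix β β ℂ) :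
    (M * (P ⊗ₖ S)).trace = (P * contractSnd M S).trace := by
  simp only [Matrix.trace, Matrix.diag_apply, Matrix.mul_apply, Matrix.kroneckerMap_apply,
    contractSnd, Matrix.of_apply, Fintype.sum_prod_type, Finset.mul_sum]
  simp only [← Fintype.sum_prod_type']
  let e : α × β × α × β ≃ α × α × β × β :=
    { toFun := fun z => (z.2.2.1, z.1, z.2.1, z.2.2.2)
      invFun := fun z => (z.2.1, z.2.2.1, z.1, z.2.2.2)
      left_inv := fun _ => rfl
      right_inv := fun _ => rfl }
  refine Fintype.sum_equiv e _ _ fun z => ?_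
  simp only [e, Equiv.coe_fn_mk]
  ring

/-- Summing a positive semidefinite matrix over the blocks of a product index
preserves positivity. -/
theorem posSemidef_sum_blocks {ι κ : Type*} [Fintype ι] [Fintype κ]
    {G : Matrix (ι × κ) (ι × κ) ℂ} (hG : G.PosSemidef) :
    (Matrix.of fun x y => ∑ k, ∑ m, G (x, k) (y, m)).PosSemidef := by
  classical
  let V : Matrix (ι × κ) ι ℂ := Matrix.of fun xk y => if xk.1 = y then 1 else 0
  convert hG.conjTranspose_mul_mul_same V using 1
  ext x y
  simp only [V, Matrix.mul_apply, Matrix.conjTranspose_apply, Matrix.of_apply,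
    Fintype.sum_prod_type_right, apply_ite star, star_one, star_zero, ite_mul, mul_ite, one_mul,
    mul_one, zero_mul, mul_zero, Finset.sum_ite_eq', Finset.mem_univ, if_true]
  exact Finset.sum_comm

/-- The state on `α × β × ι` obtained from the transpose of `ρ` by applying to the last factor
the completely positive map with Choi matrix `M`. -/
def contractState {α β ι : Type*} [Fintype ι] (M : Matrix (ι × ι) (ι × ι) ℂ)
    (ρ : Matrix (α × β × ι) (α × β × ι) ℂ) : Matrix (α × β × ι) (α × β × ι) ℂ :=
  Matrix.of fun x y => ∑ k, ∑ m,
    M (x.2.2, k) (y.2.2, m) * ρ (y.1, y.2.1, m) (x.1, x.2.1, k)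

theorem posSemidef_contractState {α β ι : Type*} [Fintype α] [Fintype β] [Fintype ι]
    {M : Matrix (ι × ι) (ι × ι) ℂ} {ρ : Matrix (α × β × ι) (α × β × ι) ℂ}
    (hM : M.PosSemidef) (hρ : ρ.PosSemidef) : (contractState M ρ).PosSemidef := by
  have hMρ : (M ⊗ₖ ρᵀ).PosSemidef := hM.kronecker hρ.transpose
  have hsum := posSemidef_sum_blocks (hMρ.submatrix
    fun z : (α × β × ι) × ι => ((z.1.2.2, z.2), (z.1.1, z.1.2.1, z.2)))
  simpa only [contractState, Matrix.submatrix_apply, Matrix.kroneckerMap_apply,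
    Matrix.transpose_apply] using hsum

theorem ptrace12_kronecker_mul_apply {α β ι : Type*} [Fintype α] [Fintype β] [Fintype ι]
    [DecidableEq ι] (M : Matrix α α ℂ) (N : Matrix β β ℂ)
    (ρ : Matrix (α × β × ι) (α × β × ι) ℂ) (i j : ι) :
    ptrace12 ((M ⊗ₖ (N ⊗ₖ (1 : Matrix ι ι ℂ))) * ρ) i j =
      ∑ p, ∑ q, ∑ p', ∑ q', M p p' * N q q' * ρ (p', q', i) (p, q, j) := by
  simp [ptrace12, Matrix.mul_apply, Fintype.sum_prod_type, Matrix.one_apply, mul_assoc]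

theorem contractSnd_ptrace12 {α β ι : Type*} [Fintype α] [Fintype β] [Fintype ι]
    [DecidableEq ι] (K : Matrix (ι × ι) (ι × ι) ℂ) (M : Matrix α α ℂ) (N : Matrix β β ℂ)
    (ρ : Matrix (α × β × ι) (α × β × ι) ℂ) :
    contractSnd K (ptrace12 ((M ⊗ₖ (N ⊗ₖ (1 : Matrix ι ι ℂ))) * ρ)) =
      ptrace12 ((Mᵀ ⊗ₖ (Nᵀ ⊗ₖ (1 : Matrix ι ι ℂ))) * contractState K ρ) := by
  ext i j
  simp only [contractSnd, Matrix.of_apply, ptrace12_kronecker_mul_apply, contractState,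
    Matrix.transpose_apply, Finset.mul_sum, ← Fintype.sum_prod_type']
  let e : ι × ι × α × β × α × β ≃ α × β × α × β × ι × ι :=
    { toFun := fun z => (z.2.2.2.2.1, z.2.2.2.2.2, z.2.2.1, z.2.2.2.1, z.1, z.2.1)
      invFun := fun z => (z.2.2.2.2.1, z.2.2.2.2.2, z.2.2.1, z.2.2.2.1, z.1, z.2.1)
      left_inv := fun _ => rfl
      right_inv := fun _ => rfl }
  refine Fintype.sum_equiv e _ _ fun z => ?_
  simp only [e, Equiv.coe_fn_mk]
  ring

/-- Contracting a quantum assemblage against a positive semidefinite matrix yields a nonnegative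
multiple of a quantum assemblage. -/
theorem IsQuantumAssemblage.contractSnd_eq_smul {A B X Y ι : Type*} [Fintype A] [Fintype B]
    [Fintype ι] [DecidableEq ι] {σ : A → B → X → Y → Matrix ι ι ℂ}
    (hσ : IsQuantumAssemblage σ) {K : Matrix (ι × ι) (ι × ι) ℂ} (hK : K.PosSemidef) :
    ∃ (t : ℝ) (τ : A → B → X → Y → Matrix ι ι ℂ), 0 ≤ t ∧ IsQuantumAssemblage τ ∧
      ∀ a b x y, contractSnd K (σ a b x y) = (t : ℂ) • τ a b x y := by
  obtain ⟨nA, nB, ρ, M, N, hρ, hρ1, hM, hM1, hN, hN1, h⟩ := id hσ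
  have hS := posSemidef_contractState hK hρ
  set S := contractState K ρ
  have hcontract : ∀ a b x y, contractSnd K (σ a b x y) =
      ptrace12 (((M a x)ᵀ ⊗ₖ ((N b y)ᵀ ⊗ₖ (1 : Matrix ι ι ℂ))) * S) := fun a b x y => by
    rw [h, contractSnd_ptrace12]
  by_cases h0 : S.trace = 0
  · refine ⟨0, σ, le_rfl, hσ, fun a b x y => ?_⟩
    rw [hcontract, hS.trace_eq_zero_iff.mp h0]
    ext
    simp [ptrace12]
  · obtain ⟨t, ht, hts⟩ : ∃ t : ℝ, 0 ≤ t ∧ S.trace = (t : ℂ) := by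
      obtain ⟨hre, him⟩ := Complex.nonneg_iff.mp hS.trace_nonneg
      exact ⟨S.trace.re, hre, Complex.ext rfl (by simp [← him])⟩
    have ht0 : (t : ℂ) ≠ 0 := hts ▸ h0
    refine ⟨t, fun a b x y =>
      ptrace12 (((M a x)ᵀ ⊗ₖ ((N b y)ᵀ ⊗ₖ (1 : Matrix ι ι ℂ))) * ((t : ℂ)⁻¹ • S)), ht,
      ⟨nA, nB, (t : ℂ)⁻¹ • S, fun a x => (M a x)ᵀ, fun b y => (N b y)ᵀ, ?_, ?_,
        fun a x => (hM a x).transpose, fun x => ?_, fun b y => (hN b y).transpose, fun y => ?_,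
        fun _ _ _ _ => rfl⟩, fun a b x y => ?_⟩
    · exact hS.smul (by exact_mod_cast inv_nonneg.mpr ht)
    · rw [Matrix.trace_smul, hts, smul_eq_mul, inv_mul_cancel₀ ht0]
    · rw [← Matrix.transpose_sum, hM1, Matrix.transpose_one]
    · rw [← Matrix.transpose_sum, hN1, Matrix.transpose_one]
    · rw [hcontract]
      ext i j
      simp only [ptrace12, Matrix.mul_smul, Matrix.smul_apply, Matrix.of_apply, smul_eq_mul,
        ← Finset.mul_sum]
      rw [mul_inv_cancel_left₀ ht0]

theorem stmt10 {A B X Y : Type*} [Fintype A] [Fintype B] [Fintype X] [Fintype Y]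
    (f : A × B × Fin 2 × X × Y × Fin 3 → ℝ)
    (hpos : ∀ σ : A → B → X → Y → Matrix (Fin 2) (Fin 2) ℂ, IsQuantumAssemblage σ →
      0 ≤ (∑ a, ∑ b, ∑ d, ∑ x, ∑ y, ∑ w,
        (f (a, b, d, x, y, w) : ℂ) * (PProj d w * σ a b x y).trace).re)
    (σ : A → B → X → Y → Matrix (Fin 2) (Fin 2) ℂ) (hσ : IsQuantumAssemblage σ)
    (M₀ : Matrix (Fin 2 × Fin 2) (Fin 2 × Fin 2) ℂ)
    (hM₀ : M₀.PosSemidef) (hM₀le : (1 - M₀).PosSemidef) :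
    0 ≤ (∑ a, ∑ b, ∑ d, ∑ x, ∑ y, ∑ w,
      (f (a, b, d, x, y, w) : ℂ) * (M₀ * (PProj d w ⊗ₖ σ a b x y)).trace).re := by
  obtain ⟨t, τ, ht, hτ, h⟩ := hσ.contractSnd_eq_smul hM₀
  refine (mul_nonneg ht (hpos τ hτ)).trans_eq ?_
  rw [← Complex.re_ofReal_mul]
  simp only [trace_mul_kronecker_eq_trace_mul_contractSnd, h, Matrix.mul_smul,
    Matrix.trace_smul, smul_eq_mul, Finset.mul_sum, mul_left_comm _ (t : ℂ)]
end

section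
/- Let A, B, X, Y be finite sets and let f : A × B × Fin 2 × X × Y × Fin 3 → ℝ. Suppose that for every quantum assemblage (σ_{ab|xy}) of 2×2 matrices, the real part of ∑_{a,b,d,x,y,w} f(a,b,d,x,y,w)·Tr(Π_{d,w}·σ_{ab|xy}) is nonnegative. For r ∈ [0,1] define the 4×4 matrices σ^R_{d|w} := r·(Π_{d,w} ⊗ E₀₀) + (1−r)·(Π_{d,w}ᵀ ⊗ E₁₁). Then for every r ∈ [0,1], every quantum assemblage (σ_{ab|xy}) of 2×2 matrices, and every positive semidefinite matrix M₀ on (ℂ² ⊗ ℂ²) ⊗ ℂ² (an 8×8 matrix indexed by (Fin 2 × Fin 2) × Fin 2) with M₀ ≤ 1, the real part of ∑_{a,b,d,x,y,w} f(a,b,d,x,y,w)·Tr(M₀·(σ^R_{d|w} ⊗ σ_{ab|xy})) is nonnegative. -/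
open Matrix Kronecker Complex
open scoped BigOperators ComplexOrder

/-- The reference assemblage elements `σ^R_{d|w} = r (Π_{d,w} ⊗ E₀₀) + (1-r) (Π_{d,w}ᵀ ⊗ E₁₁)`. -/
noncomputable def sigmaR (r : ℝ) (d : Fin 2) (w : Fin 3) :
    Matrix (Fin 2 × Fin 2) (Fin 2 × Fin 2) ℂ :=
  (r : ℂ) • (PProj d w ⊗ₖ E00) + ((1 - r : ℝ) : ℂ) • ((PProj d w)ᵀ ⊗ₖ E11)

lemma ptrace12_smul {α β γ : Type*} [Fintype α] [Fintype β] (c : ℂ)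
    (X : Matrix (α × β × γ) (α × β × γ) ℂ) : ptrace12 (c • X) = c • ptrace12 X := by
  ext i j
  simp [ptrace12, Finset.mul_sum]

lemma ptrace12_local_mul_apply {α β γ : Type*} [Fintype α] [Fintype β] [Fintype γ] [DecidableEq γ]
    (M : Matrix α α ℂ) (N : Matrix β β ℂ) (ρ : Matrix (α × β × γ) (α × β × γ) ℂ) (i j : γ) :
    ptrace12 ((M ⊗ₖ (N ⊗ₖ (1 : Matrix γ γ ℂ))) * ρ) i j =
      ∑ u : α × β, ∑ v : α × β, M u.1 v.1 * N u.2 v.2 * ρ (v.1, v.2, i) (u.1, u.2, j) := by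
  simp [ptrace12, Matrix.mul_apply, Fintype.sum_prod_type, Matrix.one_apply]

lemma transpose_ptrace12_local_mul {α β γ : Type*} [Fintype α] [Fintype β] [Fintype γ]
    [DecidableEq γ] (M : Matrix α α ℂ) (N : Matrix β β ℂ)
    (ρ : Matrix (α × β × γ) (α × β × γ) ℂ) :
    (ptrace12 ((M ⊗ₖ (N ⊗ₖ (1 : Matrix γ γ ℂ))) * ρ))ᵀ =
      ptrace12 ((Mᵀ ⊗ₖ (Nᵀ ⊗ₖ (1 : Matrix γ γ ℂ))) * ρᵀ) := by
  ext i j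
  simp only [transpose_apply, ptrace12_local_mul_apply]
  exact Finset.sum_comm

lemma sum_rotate {α κ l : Type*} [Fintype α] [Fintype κ] [Fintype l] (F : α → κ → l → ℂ) :
    ∑ p, ∑ i, ∑ j, F p i j = ∑ i, ∑ j, ∑ p, F p i j := by
  rw [Finset.sum_comm]
  exact Finset.sum_congr rfl fun _ _ => Finset.sum_comm

lemma ptrace12_conj_local {α β γ : Type*} [Fintype α] [Fintype β] [Fintype γ]
    [DecidableEq α] [DecidableEq β] (K : Matrix γ γ ℂ)
    (X : Matrix (α × β × γ) (α × β × γ) ℂ) :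
    ptrace12 (((1 : Matrix α α ℂ) ⊗ₖ ((1 : Matrix β β ℂ) ⊗ₖ K)) * X *
      ((1 : Matrix α α ℂ) ⊗ₖ ((1 : Matrix β β ℂ) ⊗ₖ K))ᴴ) = K * ptrace12 X * Kᴴ := by
  ext i j
  simp only [ptrace12, Matrix.mul_apply, Matrix.of_apply, conjTranspose_apply, kroneckerMap_apply,
    Fintype.sum_prod_type, Matrix.one_apply, ite_mul, one_mul, zero_mul, Finset.sum_ite_irrel,
    Finset.sum_const_zero, Finset.sum_ite_eq, Finset.mem_univ, if_true,
    apply_ite star, star_zero, mul_ite, mul_zero, Finset.sum_mul, Finset.mul_sum]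
  exact (Finset.sum_congr rfl fun p _ => sum_rotate _).trans (sum_rotate _)

lemma conj_ptrace12_local_mul {α β γ : Type*} [Fintype α] [Fintype β] [Fintype γ]
    [DecidableEq α] [DecidableEq β] [DecidableEq γ] (M : Matrix α α ℂ) (N : Matrix β β ℂ)
    (K : Matrix γ γ ℂ) (ρ : Matrix (α × β × γ) (α × β × γ) ℂ) :
    K * ptrace12 ((M ⊗ₖ (N ⊗ₖ (1 : Matrix γ γ ℂ))) * ρ) * Kᴴ =
      ptrace12 ((M ⊗ₖ (N ⊗ₖ (1 : Matrix γ γ ℂ))) *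
        (((1 : Matrix α α ℂ) ⊗ₖ ((1 : Matrix β β ℂ) ⊗ₖ K)) * ρ *
          ((1 : Matrix α α ℂ) ⊗ₖ ((1 : Matrix β β ℂ) ⊗ₖ K))ᴴ)) := by
  rw [← ptrace12_conj_local]
  simp only [← Matrix.mul_assoc, ← Matrix.mul_kronecker_mul, Matrix.one_mul, Matrix.mul_one]

lemma IsQuantumAssemblage.transpose {A B X Y ι : Type*} [Fintype A] [Fintype B]
    [Fintype ι] [DecidableEq ι] {σ : A → B → X → Y → Matrix ι ι ℂ}
    (hσ : IsQuantumAssemblage σ) : IsQuantumAssemblage fun a b x y => (σ a b x y)ᵀ := by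
  obtain ⟨nA, nB, ρ, M, N, hρ, htr, hM, hM1, hN, hN1, h⟩ := hσ
  refine ⟨nA, nB, ρᵀ, fun a x => (M a x)ᵀ, fun b y => (N b y)ᵀ, hρ.transpose,
    by rw [trace_transpose, htr], fun a x => (hM a x).transpose, fun x => ?_,
    fun b y => (hN b y).transpose, fun y => ?_, fun a b x y => ?_⟩
  · rw [← transpose_sum, hM1, transpose_one]
  · rw [← transpose_sum, hN1, transpose_one]
  · simp only [h, transpose_ptrace12_local_mul]

/-- A linear functional on assemblages, obtained from a Bell functional by pairing with the Pauli
eigenprojectors. -/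
noncomputable def pauliFunctional {A B X Y : Type*} [Fintype A] [Fintype B] [Fintype X] [Fintype Y]
    (f : A × B × Fin 2 × X × Y × Fin 3 → ℝ) :
    (A → B → X → Y → Matrix (Fin 2) (Fin 2) ℂ) →ₗ[ℂ] ℂ where
  toFun σ := ∑ a, ∑ b, ∑ d, ∑ x, ∑ y, ∑ w,
    (f (a, b, d, x, y, w) : ℂ) * (PProj d w * σ a b x y).trace
  map_add' σ τ := by
    simp only [Pi.add_apply, trace_add, mul_add, Finset.sum_add_distrib]
  map_smul' c σ := by
    simp only [Pi.smul_apply, Matrix.mul_smul, trace_smul, smul_eq_mul, RingHom.id_apply,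
      Finset.mul_sum, mul_left_comm _ c]

section

variable {A B X Y : Type*} [Fintype A] [Fintype B] [Fintype X] [Fintype Y]
  {f : A × B × Fin 2 × X × Y × Fin 3 → ℝ}

lemma pauliFunctional_conj_nonneg
    (hpos : ∀ σ, IsQuantumAssemblage σ → 0 ≤ (pauliFunctional f σ).re)
    {σ : A → B → X → Y → Matrix (Fin 2) (Fin 2) ℂ} (hσ : IsQuantumAssemblage σ)
    (K : Matrix (Fin 2) (Fin 2) ℂ) :
    0 ≤ (pauliFunctional f fun a b x y => K * σ a b x y * Kᴴ).re := by
  obtain ⟨nA, nB, ρ, M, N, hρ, -, hM, hM1, hN, hN1, h⟩ := hσ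
  simp only [h, conj_ptrace12_local_mul]
  set L := (1 : Matrix (Fin nA) (Fin nA) ℂ) ⊗ₖ ((1 : Matrix (Fin nB) (Fin nB) ℂ) ⊗ₖ K)
  have hρ' : (L * ρ * Lᴴ).PosSemidef := hρ.mul_mul_conjTranspose_same L
  generalize L * ρ * Lᴴ = ρ' at hρ'
  obtain ⟨t, ht, htr⟩ : ∃ t : ℝ, 0 ≤ t ∧ (t : ℂ) = ρ'.trace := by
    obtain ⟨hre, him⟩ := Complex.le_def.1 hρ'.trace_nonneg
    exact ⟨ρ'.trace.re, hre, Complex.ext rfl him⟩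
  rcases ht.eq_or_lt with rfl | ht0
  · rw [ofReal_zero, eq_comm, hρ'.trace_eq_zero_iff] at htr
    subst htr
    have h0 : (fun (a : A) (b : B) (x : X) (y : Y) =>
        ptrace12 ((M a x ⊗ₖ (N b y ⊗ₖ (1 : Matrix (Fin 2) (Fin 2) ℂ))) * 0)) = 0 := by
      ext
      simp [ptrace12]
    rw [h0, map_zero, zero_re]
  · have hne : (t : ℂ) ≠ 0 := ofReal_ne_zero.2 ht0.ne'
    have hq := hpos (fun a b x y => ptrace12 ((M a x ⊗ₖ (N b y ⊗ₖ 1)) * ((t : ℂ)⁻¹ • ρ')))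
      ⟨nA, nB, (t : ℂ)⁻¹ • ρ', M, N, hρ'.smul
        (by rw [← ofReal_inv]; exact_mod_cast (inv_pos.2 ht0).le),
        by rw [trace_smul, ← htr, smul_eq_mul, inv_mul_cancel₀ hne],
        hM, hM1, hN, hN1, fun _ _ _ _ => rfl⟩
    have hscale : (fun a b x y => ptrace12 ((M a x ⊗ₖ (N b y ⊗ₖ 1)) * ρ')) =
        (t : ℂ) • fun a b x y => (ptrace12 ((M a x ⊗ₖ (N b y ⊗ₖ 1)) * ((t : ℂ)⁻¹ • ρ')) :
          Matrix (Fin 2) (Fin 2) ℂ) := by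
      funext a b x y
      simp only [Pi.smul_apply, Matrix.mul_smul, ptrace12_smul, smul_smul, mul_inv_cancel₀ hne,
        one_smul]
    rw [hscale, map_smul, smul_eq_mul, re_ofReal_mul]
    exact mul_nonneg ht hq

end

/-- The `2 × 2` block of a row of `C` selected by the middle qubit being in the state `s`. -/
def rowBlock {κ : Type*} (C : Matrix κ ((Fin 2 × Fin 2) × Fin 2) ℂ) (k : κ) (s : Fin 2) :
    Matrix (Fin 2) (Fin 2) ℂ :=
  Matrix.of fun i j => C k ((i, s), j)

lemma trace_conjTranspose_mul_self_mul_sigmaR_kronecker {κ : Type*} [Fintype κ]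
    (C : Matrix κ ((Fin 2 × Fin 2) × Fin 2) ℂ) (r : ℝ) (d : Fin 2) (w : Fin 3)
    (S : Matrix (Fin 2) (Fin 2) ℂ) :
    (Cᴴ * C * (sigmaR r d w ⊗ₖ S)).trace = (PProj d w * ∑ k,
      ((r : ℂ) • ((rowBlock C k 0).map star * Sᵀ * ((rowBlock C k 0).map star)ᴴ) +
        ((1 - r : ℝ) : ℂ) • (rowBlock C k 1 * S * (rowBlock C k 1)ᴴ))).trace := by
  rw [Matrix.mul_assoc, trace_mul_comm, Matrix.mul_sum, trace_sum, trace]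
  refine Finset.sum_congr rfl fun k _ => ?_
  unfold sigmaR
  generalize PProj d w = P
  simp only [diag_apply, trace_fin_two, Matrix.mul_apply, Fintype.sum_prod_type, Fin.sum_univ_two,
    E00, E11, Matrix.add_apply, Matrix.smul_apply, smul_eq_mul, kroneckerMap_apply,
    transpose_apply, conjTranspose_apply, map_apply, rowBlock, Matrix.of_apply, star_star,
    Matrix.cons_val_zero, Matrix.cons_val_one, Matrix.cons_val', Matrix.cons_val_fin_one]
  ring

theorem stmt11 {A B X Y : Type*} [Fintype A] [Fintype B] [Fintype X] [Fintype Y]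
    (f : A × B × Fin 2 × X × Y × Fin 3 → ℝ)
    (hpos : ∀ σ : A → B → X → Y → Matrix (Fin 2) (Fin 2) ℂ, IsQuantumAssemblage σ →
      0 ≤ (∑ a, ∑ b, ∑ d, ∑ x, ∑ y, ∑ w,
        (f (a, b, d, x, y, w) : ℂ) * (PProj d w * σ a b x y).trace).re)
    (r : ℝ) (hr0 : 0 ≤ r) (hr1 : r ≤ 1)
    (σ : A → B → X → Y → Matrix (Fin 2) (Fin 2) ℂ) (hσ : IsQuantumAssemblage σ)
    (M₀ : Matrix ((Fin 2 × Fin 2) × Fin 2) ((Fin 2 × Fin 2) × Fin 2) ℂ)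
    (hM₀ : M₀.PosSemidef) (hM₀le : (1 - M₀).PosSemidef) :
    0 ≤ (∑ a, ∑ b, ∑ d, ∑ x, ∑ y, ∑ w,
      (f (a, b, d, x, y, w) : ℂ) * (M₀ * (sigmaR r d w ⊗ₖ σ a b x y)).trace).re := by
  obtain ⟨C, rfl⟩ : ∃ C : Matrix ((Fin 2 × Fin 2) × Fin 2) ((Fin 2 × Fin 2) × Fin 2) ℂ,
      M₀ = Cᴴ * C := by
    open scoped MatrixOrder Matrix.Norms.L2Operator in
    exact CStarAlgebra.nonneg_iff_eq_star_mul_self.1 hM₀.nonneg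
  simp only [trace_conjTranspose_mul_self_mul_sigmaR_kronecker]
  let τ (k : (Fin 2 × Fin 2) × Fin 2) (a : A) (b : B) (x : X) (y : Y) :=
    (rowBlock C k 0).map star * (σ a b x y)ᵀ * ((rowBlock C k 0).map star)ᴴ
  let τ' (k : (Fin 2 × Fin 2) × Fin 2) (a : A) (b : B) (x : X) (y : Y) :=
    rowBlock C k 1 * σ a b x y * (rowBlock C k 1)ᴴ
  have hτ : 0 ≤ (pauliFunctional f (∑ k, ((r : ℂ) • τ k + ((1 - r : ℝ) : ℂ) • τ' k))).re := by
    simp only [map_sum, map_add, map_smul, smul_eq_mul, re_sum, add_re, re_ofReal_mul]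
    exact Finset.sum_nonneg fun k _ => add_nonneg
      (mul_nonneg hr0 (pauliFunctional_conj_nonneg hpos hσ.transpose _))
      (mul_nonneg (sub_nonneg.2 hr1) (pauliFunctional_conj_nonneg hpos hσ _))
  convert hτ using 3
  simp only [pauliFunctional, LinearMap.coe_mk, AddHom.coe_mk, Finset.sum_apply, Pi.add_apply,
    Pi.smul_apply, τ, τ']
end

section
/- Let A, B, X, Y, C, Z, D, W be finite sets. Let (σ_{ab|xy}) be a quantum assemblage of m×m matrices (index sets A, B, X, Y), and let (σ_{d|w}) be a bipartite quantum assemblage of n×n matrices (index sets D, W), i.e. there exist a finite dimension n_D, a density matrix ρ' on ℂ^{n_D} ⊗ ℂ^n, and POVMs {L_{d|w}}_{d∈D} on ℂ^{n_D} with σ_{d|w} = Tr₁[(L_{d|w} ⊗ 1_n)·ρ']. Let {K_{c|z}}_{c∈C} for z ∈ Z be POVMs on ℂ^m ⊗ ℂ^n. Define p(a,b,c,d|x,y,z,w) := Re Tr[K_{c|z}·(σ_{ab|xy} ⊗ σ_{d|w})]. Then p admits a four-partite quantum realization: there exist finite dimensions n_A, n_B, n_C, n_D', a density matrix ρ on ℂ^{n_A}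 ⊗ ℂ^{n_B} ⊗ ℂ^{n_C} ⊗ ℂ^{n_D'}, and POVMs {M_{a|x}} on ℂ^{n_A}, {N_{b|y}} on ℂ^{n_B}, {K'_{c|z}} on ℂ^{n_C}, {L'_{d|w}} on ℂ^{n_D'} such that p(a,b,c,d|x,y,z,w) = Re Tr[(M_{a|x} ⊗ N_{b|y} ⊗ K'_{c|z} ⊗ L'_{d|w})·ρ] for all a,b,c,d,x,y,z,w. -/
open Matrix Kronecker Complex
open scoped BigOperators ComplexOrder

theorem trace_submatrix_equiv_self {ι κ R : Type*} [Fintype ι] [Fintype κ] [AddCommMonoid R]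
    (P : Matrix κ κ R) (e : ι ≃ κ) : (P.submatrix e e).trace = P.trace :=
  e.sum_comp P.diag

/-- Regroups `(a, b, c, d)`, with `c` encoding a pair `(i, k)` through `f`, as `((a, b, i), (d, k))`. -/
def regroupEquiv {α β γ δ ε κ : Type*} (f : γ × δ ≃ κ) :
    α × β × κ × ε ≃ (α × β × γ) × (ε × δ) where
  toFun t := ((t.1, t.2.1, (f.symm t.2.2.1).1), (t.2.2.2, (f.symm t.2.2.1).2))
  invFun t := (t.1.1, t.1.2.1, f (t.1.2.2, t.2.2), t.2.1)
  left_inv t := by simp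
  right_inv t := by simp

theorem ptrace12_kronecker_one_mul_apply {α β γ : Type*} [Fintype α] [Fintype β] [Fintype γ]
    [DecidableEq γ] (M : Matrix α α ℂ) (N : Matrix β β ℂ)
    (ρ : Matrix (α × β × γ) (α × β × γ) ℂ) (i j : γ) :
    ptrace12 ((M ⊗ₖ (N ⊗ₖ (1 : Matrix γ γ ℂ))) * ρ) i j =
      ∑ p, ∑ q, ∑ p', ∑ q', M p p' * N q q' * ρ (p', q', i) (p, q, j) := by
  simp [ptrace12, Matrix.mul_apply, Fintype.sum_prod_type, Matrix.one_apply, mul_assoc]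

theorem ptrace1_kronecker_one_mul_apply {α β : Type*} [Fintype α] [Fintype β] [DecidableEq β]
    (L : Matrix α α ℂ) (ρ : Matrix (α × β) (α × β) ℂ) (i j : β) :
    ptrace1 ((L ⊗ₖ (1 : Matrix β β ℂ)) * ρ) i j =
      ∑ r, ∑ r', L r r' * ρ (r', i) (r, j) := by
  simp [ptrace1, Matrix.mul_apply, Fintype.sum_prod_type, Matrix.one_apply]

/-- Measuring `K` on the trusted systems of two assemblages equals measuring all parties of the
product of the underlying states. -/
theorem trace_mul_ptrace12_kronecker_ptrace1 {α β γ δ ε κ : Type*} [Fintype α] [Fintype β]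
    [Fintype γ] [Fintype δ] [Fintype ε] [Fintype κ] [DecidableEq γ] [DecidableEq δ]
    (f : γ × δ ≃ κ) (M : Matrix α α ℂ) (N : Matrix β β ℂ)
    (K : Matrix (γ × δ) (γ × δ) ℂ) (L : Matrix ε ε ℂ)
    (ρ : Matrix (α × β × γ) (α × β × γ) ℂ) (τ : Matrix (ε × δ) (ε × δ) ℂ) :
    (K * (ptrace12 ((M ⊗ₖ (N ⊗ₖ (1 : Matrix γ γ ℂ))) * ρ) ⊗ₖ
        ptrace1 ((L ⊗ₖ (1 : Matrix δ δ ℂ)) * τ))).trace =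
      ((M ⊗ₖ (N ⊗ₖ (K.submatrix f.symm f.symm ⊗ₖ L))) *
        (ρ ⊗ₖ τ).submatrix (regroupEquiv f) (regroupEquiv f)).trace := by
  have hsum (g : κ → ℂ) : ∑ c, g c = ∑ t : γ × δ, g (f t) := (f.sum_comp g).symm
  simp only [Matrix.trace, Matrix.diag_apply, Matrix.mul_apply, kroneckerMap_apply,
    ptrace12_kronecker_one_mul_apply, ptrace1_kronecker_one_mul_apply, submatrix_apply,
    regroupEquiv, Equiv.coe_fn_mk, Fintype.sum_prod_type (α₁ := α),
    Fintype.sum_prod_type (α₁ := β), Fintype.sum_prod_type (α₁ := κ), hsum,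
    Equiv.symm_apply_apply, Finset.sum_mul, Finset.mul_sum]
  simp only [← Fintype.sum_prod_type']
  exact Fintype.sum_equiv
    { toFun := fun (i, j, r, r', p, q, p', q') => (p, q, i, r, p', q', j, r')
      invFun := fun (p, q, i, r, p', q', j, r') => (i, j, r, r', p, q, p', q')
      left_inv := fun _ => rfl
      right_inv := fun _ => rfl } _ _ fun _ => by dsimp only [Equiv.coe_fn_mk]; ring

theorem stmt14 {A B X Y C Z D W : Type*}
    [Fintype A] [Fintype B] [Fintype C] [Fintype D] {m n : ℕ}
    (σAB : A → B → X → Y → Matrix (Fin m) (Fin m) ℂ)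
    (hAB : IsQuantumAssemblage σAB)
    (σD : D → W → Matrix (Fin n) (Fin n) ℂ)
    (hD : ∃ (nD : ℕ) (ρ' : Matrix (Fin nD × Fin n) (Fin nD × Fin n) ℂ)
        (L : D → W → Matrix (Fin nD) (Fin nD) ℂ),
        ρ'.PosSemidef ∧ ρ'.trace = 1 ∧
        (∀ d w, (L d w).PosSemidef) ∧ (∀ w, ∑ d, L d w = 1) ∧
        ∀ d w, σD d w = ptrace1 ((L d w ⊗ₖ (1 : Matrix (Fin n) (Fin n) ℂ)) * ρ'))
    (K : C → Z → Matrix (Fin m × Fin n) (Fin m × Fin n) ℂ)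
    (hKpsd : ∀ c z, (K c z).PosSemidef) (hKsum : ∀ z, ∑ c, K c z = 1) :
    ∃ (nA nB nC nD' : ℕ)
      (ρ : Matrix (Fin nA × Fin nB × Fin nC × Fin nD')
        (Fin nA × Fin nB × Fin nC × Fin nD') ℂ)
      (M : A → X → Matrix (Fin nA) (Fin nA) ℂ)
      (N : B → Y → Matrix (Fin nB) (Fin nB) ℂ)
      (K' : C → Z → Matrix (Fin nC) (Fin nC) ℂ)
      (L' : D → W → Matrix (Fin nD') (Fin nD') ℂ),
      ρ.PosSemidef ∧ ρ.trace = 1 ∧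
      (∀ a x, (M a x).PosSemidef) ∧ (∀ x, ∑ a, M a x = 1) ∧
      (∀ b y, (N b y).PosSemidef) ∧ (∀ y, ∑ b, N b y = 1) ∧
      (∀ c z, (K' c z).PosSemidef) ∧ (∀ z, ∑ c, K' c z = 1) ∧
      (∀ d w, (L' d w).PosSemidef) ∧ (∀ w, ∑ d, L' d w = 1) ∧
      ∀ a b c d x y z w,
        (K c z * (σAB a b x y ⊗ₖ σD d w)).trace.re =
          ((M a x ⊗ₖ (N b y ⊗ₖ (K' c z ⊗ₖ L' d w))) * ρ).trace.re := by
  obtain ⟨nA, nB, ρ, M, N, hρ, hρtr, hM, hMsum, hN, hNsum, hσAB⟩ := hAB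
  obtain ⟨nD, ρ', L, hρ', hρtr', hL, hLsum, hσD⟩ := hD
  let f : Fin m × Fin n ≃ Fin (m * n) := finProdFinEquiv
  refine ⟨nA, nB, m * n, nD, (ρ ⊗ₖ ρ').submatrix (regroupEquiv f) (regroupEquiv f), M, N,
    fun c z => (K c z).submatrix f.symm f.symm, L, (hρ.kronecker hρ').submatrix _, ?_,
    hM, hMsum, hN, hNsum, fun c z => (hKpsd c z).submatrix _, fun z => ?_, hL, hLsum, ?_⟩
  · rw [trace_submatrix_equiv_self, trace_kronecker, hρtr, hρtr', one_mul]
  · ext i j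
    have h := congr_fun₂ (hKsum z) (f.symm i) (f.symm j)
    simpa [Matrix.sum_apply, Matrix.one_apply] using h
  · intro a b c d x y z w
    rw [hσAB, hσD, trace_mul_ptrace12_kronecker_ptrace1 f]
end

section
/- Let p(c,d|z,w) ∈ ℝ for c, d ∈ {0,1}, z ∈ {1,…,6}, w ∈ {1,2,3}, and suppose p is local: there exist a finite set Λ, nonnegative weights q(λ) with ∑_λ q(λ) = 1, and functions p_C(c|z,λ) ≥ 0 with ∑_c p_C(c|z,λ) = 1 and p_D(d|w,λ) ≥ 0 with ∑_d p_D(d|w,λ) = 1, such that p(c,d|z,w) = ∑_λ q(λ)·p_C(c|z,λ)·p_D(d|w,λ). Define E_{z,w} := ∑_{c,d} (−1)^{c+d}·p(c,d|z,w). Then E_{1,1} + E_{1,2} − E_{2,1} + E_{2,2} + E_{3,1} + E_{4,1} + E_{3,3} − E_{4,3} + E_{5,2} + E_{6,2} + E_{5,3} − E_{6,3} ≤ 6. -/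
open Matrix Kronecker Complex
open scoped BigOperators ComplexOrder

/-- The correlator `E_{z,w} = ∑_{c,d} (−1)^{c+d} p(c,d|z,w)`. -/
noncomputable def Corr (p : Fin 2 → Fin 2 → Fin 6 → Fin 3 → ℝ) (z : Fin 6) (w : Fin 3) : ℝ :=
  ∑ c : Fin 2, ∑ d : Fin 2, (-1 : ℝ) ^ ((c : ℕ) + (d : ℕ)) * p c d z w

theorem chsh_le_two {a b c d : ℝ} (ha : |a| ≤ 1) (hb : |b| ≤ 1) (hc : |c| ≤ 1) (hd : |d| ≤ 1) :
    a * (c + d) + b * (d - c) ≤ 2 := by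
  have h₁ : a * (c + d) ≤ |c + d| :=
    (le_abs_self _).trans (by rw [abs_mul]; exact mul_le_of_le_one_left (abs_nonneg _) ha)
  have h₂ : b * (d - c) ≤ |d - c| :=
    (le_abs_self _).trans (by rw [abs_mul]; exact mul_le_of_le_one_left (abs_nonneg _) hb)
  have h₃ : |c + d| + |d - c| ≤ 2 := by
    rw [abs_le] at hc hd
    rcases abs_cases (c + d) with h | h <;> rcases abs_cases (d - c) with h' | h' <;> linarith
  linarith

theorem abs_sub_le_one_of_nonneg_of_sum_eq_one {f : Fin 2 → ℝ} (hf : ∀ i, 0 ≤ f i)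
    (hf1 : ∑ i, f i = 1) : |f 0 - f 1| ≤ 1 := by
  rw [Fin.sum_univ_two] at hf1
  rw [abs_le]
  constructor <;> linarith [hf 0, hf 1]

theorem Corr_eq_sum {Λ : Type*} [Fintype Λ] {p : Fin 2 → Fin 2 → Fin 6 → Fin 3 → ℝ}
    {q : Λ → ℝ} {pC : Fin 2 → Fin 6 → Λ → ℝ} {pD : Fin 2 → Fin 3 → Λ → ℝ}
    (hp : ∀ c d z w, p c d z w = ∑ l, q l * pC c z l * pD d w l) (z : Fin 6) (w : Fin 3) :
    Corr p z w = ∑ l, q l * ((pC 0 z l - pC 1 z l) * (pD 0 w l - pD 1 w l)) := by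
  simp only [Corr, hp, Fin.sum_univ_two, Finset.mul_sum, ← Finset.sum_add_distrib]
  refine Finset.sum_congr rfl fun l _ => ?_
  simp only [Fin.val_zero, Fin.val_one]
  ring

/- Measurement settings `z ∈ {1,…,6}` and `w ∈ {1,2,3}` are encoded as `Fin 6` and `Fin 3`
(so e.g. `E_{1,1}` is `Corr p 0 0`, `E_{6,3}` is `Corr p 5 2`). -/
theorem stmt16 (p : Fin 2 → Fin 2 → Fin 6 → Fin 3 → ℝ)
    (Λ : Type*) [Fintype Λ] (q : Λ → ℝ)
    (hq : ∀ l, 0 ≤ q l) (hq1 : ∑ l, q l = 1)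
    (pC : Fin 2 → Fin 6 → Λ → ℝ) (pD : Fin 2 → Fin 3 → Λ → ℝ)
    (hpC : ∀ c z l, 0 ≤ pC c z l) (hpC1 : ∀ z l, ∑ c, pC c z l = 1)
    (hpD : ∀ d w l, 0 ≤ pD d w l) (hpD1 : ∀ w l, ∑ d, pD d w l = 1)
    (hp : ∀ c d z w, p c d z w = ∑ l, q l * pC c z l * pD d w l) :
    Corr p 0 0 + Corr p 0 1 - Corr p 1 0 + Corr p 1 1 + Corr p 2 0 + Corr p 3 0 +
      Corr p 2 2 - Corr p 3 2 + Corr p 4 1 + Corr p 5 1 + Corr p 4 2 - Corr p 5 2 ≤ 6 := by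
  simp only [Corr_eq_sum hp, ← Finset.sum_add_distrib, ← Finset.sum_sub_distrib]
  calc
    _ ≤ ∑ l, q l * 6 := by
      refine Finset.sum_le_sum fun l _ => ?_
      have hC z := abs_sub_le_one_of_nonneg_of_sum_eq_one (fun c => hpC c z l) (hpC1 z l)
      have hD w := abs_sub_le_one_of_nonneg_of_sum_eq_one (fun d => hpD d w l) (hpD1 w l)
      have h := mul_le_mul_of_nonneg_left
        (add_le_add (add_le_add (chsh_le_two (hC 0) (hC 1) (hD 0) (hD 1))
          (chsh_le_two (hD 0) (hD 2) (hC 3) (hC 2)))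
          (chsh_le_two (hD 1) (hD 2) (hC 5) (hC 4))) (hq l)
      linarith
    _ = 6 := by rw [← Finset.sum_mul, hq1, one_mul]
end

section
/- There exist a density matrix ρ (positive semidefinite 4×4 complex matrix with trace 1, on ℂ² ⊗ ℂ²) and POVMs {M_{c|z}}_{c∈{0,1}} on the first factor ℂ² for each z ∈ {1,…,6}, and {N_{d|w}}_{d∈{0,1}} on the second factor ℂ² for each w ∈ {1,2,3}, such that, with p(c,d|z,w) := Re Tr[(M_{c|z} ⊗ N_{d|w})·ρ] and E_{z,w} := ∑_{c,d} (−1)^{c+d}·p(c,d|z,w): (a) E_{1,1} + E_{1,2} − E_{2,1} + E_{2,2} + E_{3,1} + E_{4,1} + E_{3,3} − E_{4,3} + E_{5,2} + E_{6,2} + E_{5,3} − E_{6,3} = 6·√2; and (b) the steered assemblage on the first factor equals the reference assemblage: Tr₂[(1₂ ⊗ N_{d|w})·ρ] = (1/2)·Π_{d,w} for all d ∈ {0,1}, w ∈ {1,2,3}, where Tr₂ is the partial trace over the second tensor factor, (Tr₂ X)_{i,j} = ∑_{p} X_{(i,p),(j,p)}. -/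
open Matrix Kronecker Complex
open scoped BigOperators ComplexOrder

/-- The effect `(1 + (-1)^d v·σ) / 2` of a measurement along the Bloch vector `v`. -/
noncomputable def blochEffect (v : Fin 3 → ℝ) (d : Fin 2) : Matrix (Fin 2) (Fin 2) ℂ :=
  ((1 : ℂ) / 2) • ((1 : Matrix (Fin 2) (Fin 2) ℂ) +
    ((-1 : ℂ) ^ (d : ℕ)) • ∑ k, (v k : ℂ) • Pauli k)

/-- The maximally entangled two-qubit state. -/
noncomputable def bellState : Matrix (Fin 2 × Fin 2) (Fin 2 × Fin 2) ℂ :=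
  Matrix.of fun x y => if x.1 = x.2 ∧ y.1 = y.2 then (1 : ℂ) / 2 else 0

lemma posSemidef_of_conjTranspose_mul_self_eq {n : Type*} [Fintype n] {A : Matrix n n ℂ}
    (h : Aᴴ * A = A) : A.PosSemidef :=
  h ▸ posSemidef_conjTranspose_mul_self A

lemma blochEffect_posSemidef {v : Fin 3 → ℝ} (hv : v 0 ^ 2 + v 1 ^ 2 + v 2 ^ 2 = 1)
    (d : Fin 2) : (blochEffect v d).PosSemidef := by
  apply posSemidef_of_conjTranspose_mul_self_eq
  have hv' : (v 0 : ℂ) ^ 2 + (v 1 : ℂ) ^ 2 + (v 2 : ℂ) ^ 2 = 1 := by exact_mod_cast hv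
  ext i j
  fin_cases d <;> fin_cases i <;> fin_cases j <;>
    simp [blochEffect, Pauli, Matrix.mul_apply, Fin.sum_univ_two, Fin.sum_univ_three,
      map_ofNat (starRingEnd ℂ) 2] <;>
    first
      | ring1
      | linear_combination ((1 : ℂ) / 4) * hv' - (v 1 : ℂ) ^ 2 / 4 * Complex.I_sq

lemma sum_blochEffect (v : Fin 3 → ℝ) : ∑ d, blochEffect v d = 1 := by
  simp only [blochEffect, Fin.sum_univ_two, ← smul_add]
  ext i j
  fin_cases i <;> fin_cases j <;> simp <;> ring

lemma bellState_posSemidef : bellState.PosSemidef := by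
  apply posSemidef_of_conjTranspose_mul_self_eq
  ext ⟨a, b⟩ ⟨c, d⟩
  fin_cases a <;> fin_cases b <;> fin_cases c <;> fin_cases d <;>
    simp [bellState, Matrix.mul_apply, Fintype.sum_prod_type,
      map_ofNat (starRingEnd ℂ) 2]

lemma bellState_trace : bellState.trace = 1 := by
  simp [bellState, Matrix.trace, Fintype.sum_prod_type]

lemma trace_kronecker_mul_bellState (A B : Matrix (Fin 2) (Fin 2) ℂ) :
    ((A ⊗ₖ B) * bellState).trace = (1 / 2) * (A * Bᵀ).trace := by
  simp [bellState, Matrix.trace, Matrix.mul_apply, Fintype.sum_prod_type, Fin.sum_univ_two]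
  ring

lemma ptrace2_one_kronecker_mul_bellState (B : Matrix (Fin 2) (Fin 2) ℂ) :
    ptrace2 (((1 : Matrix (Fin 2) (Fin 2) ℂ) ⊗ₖ B) * bellState) = ((1 : ℂ) / 2) • Bᵀ := by
  ext i j
  fin_cases i <;> fin_cases j <;>
    simp [ptrace2, bellState, Matrix.mul_apply, Fintype.sum_prod_type, Fin.sum_univ_two] <;> ring

lemma corr_blochEffect (u : Fin 6 → Fin 3 → ℝ) (v : Fin 3 → Fin 3 → ℝ) (z : Fin 6) (w : Fin 3) :
    Corr (fun c d z w => ((blochEffect (u z) c ⊗ₖ blochEffect (v w) d) * bellState).trace.re) z w =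
      u z 0 * v w 0 - u z 1 * v w 1 + u z 2 * v w 2 := by
  simp only [Corr, trace_kronecker_mul_bellState]
  simp [blochEffect, Pauli, Matrix.trace, Matrix.mul_apply, Fin.sum_univ_succ]
  ring

/-- Bloch vectors of the six measurements on the first qubit. -/
noncomputable def chshDirection : Fin 6 → Fin 3 → ℝ :=
  ![![√2 / 2, √2 / 2, 0], ![-(√2 / 2), √2 / 2, 0], ![√2 / 2, 0, √2 / 2],
    ![√2 / 2, 0, -(√2 / 2)], ![0, √2 / 2, √2 / 2], ![0, √2 / 2, -(√2 / 2)]]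

/-- Bloch vectors of the transposed Pauli measurements. -/
def transposedPauliDirection : Fin 3 → Fin 3 → ℝ :=
  ![![1, 0, 0], ![0, -1, 0], ![0, 0, 1]]

lemma transpose_blochEffect_transposedPauliDirection (w : Fin 3) (d : Fin 2) :
    (blochEffect (transposedPauliDirection w) d)ᵀ = PProj d w := by
  ext i j
  fin_cases w <;> fin_cases i <;> fin_cases j <;>
    simp [blochEffect, transposedPauliDirection, PProj, Pauli, Fin.sum_univ_three] <;> ring

theorem stmt17 :
    ∃ (ρ : Matrix (Fin 2 × Fin 2) (Fin 2 × Fin 2) ℂ)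
      (M : Fin 6 → Fin 2 → Matrix (Fin 2) (Fin 2) ℂ)
      (N : Fin 3 → Fin 2 → Matrix (Fin 2) (Fin 2) ℂ),
      ρ.PosSemidef ∧ ρ.trace = 1 ∧
      (∀ z c, (M z c).PosSemidef) ∧ (∀ z, ∑ c, M z c = 1) ∧
      (∀ w d, (N w d).PosSemidef) ∧ (∀ w, ∑ d, N w d = 1) ∧
      (let p : Fin 2 → Fin 2 → Fin 6 → Fin 3 → ℝ :=
        fun c d z w => ((M z c ⊗ₖ N w d) * ρ).trace.re
       Corr p 0 0 + Corr p 0 1 - Corr p 1 0 + Corr p 1 1 + Corr p 2 0 + Corr p 3 0 +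
         Corr p 2 2 - Corr p 3 2 + Corr p 4 1 + Corr p 5 1 + Corr p 4 2 - Corr p 5 2 =
           6 * Real.sqrt 2) ∧
      ∀ d w, ptrace2 (((1 : Matrix (Fin 2) (Fin 2) ℂ) ⊗ₖ N w d) * ρ) =
        ((1 : ℂ) / 2) • PProj d w := by
  refine ⟨bellState, fun z => blochEffect (chshDirection z),
    fun w => blochEffect (transposedPauliDirection w), bellState_posSemidef, bellState_trace,
    fun z => blochEffect_posSemidef ?_, fun z => sum_blochEffect _,
    fun w => blochEffect_posSemidef ?_, fun w => sum_blochEffect _, ?_, fun d w => ?_⟩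
  · have h : √2 ^ 2 = (2 : ℝ) := Real.sq_sqrt zero_le_two
    fin_cases z <;> simp [chshDirection] <;> linear_combination h / 2
  · fin_cases w <;> simp [transposedPauliDirection]
  · simp only [corr_blochEffect]
    simp [chshDirection, transposedPauliDirection]
    ring
  · rw [ptrace2_one_kronecker_mul_bellState, transpose_blochEffect_transposedPauliDirection]
end
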